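/- Let n ≥ 2, u(λ) = λ - i, and let f ∈ C^{n-1}(ℝ). Then for all real λ₀, …, λ_{n-1}, the divided difference identity f^{[n-1]}(λ₀,…,λ_{n-1}) = Σ_{p=0}^{n-1} Σ_{0 < j₁ < ⋯ < j_p ≤ n-1} (-1)^{n-1-p} (f·u^p)^{[p]}(λ₀, λ_{j₁}, …, λ_{j_p}) · u(λ₁)^{-1} ⋯ u(λ_{n-1})^{-1} holds. -/

import Mathlib

open Finset

/-- The divided difference of `f`, defined recursively, with the convention that at
coincident last points one takes the partial derivative in the last variable. -/
noncomputable def divDiffD (f : ℝ → ℂ) : ∀ n : ℕ, (Fin (n + 1) → ℝ) → ℂ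
  | 0, l => f (l 0)
  | n + 1, l =>
      if l (Fin.last (n + 1)) = l ((Fin.last n).castSucc) then
        deriv (fun x : ℝ =>
            divDiffD f n (Function.update (fun i => l i.castSucc) (Fin.last n) x))
          (l ((Fin.last n).castSucc))
      else
        (divDiffD f n
            (Function.update (fun i => l i.castSucc) (Fin.last n) (l (Fin.last (n + 1)))) -
          divDiffD f n (fun i => l i.castSucc)) /
          (((l (Fin.last (n + 1)) : ℂ)) - ((l ((Fin.last n).castSucc) : ℂ)))

/-- Averaging along segments from `a` against a monomial weight preserves smoothness. -/
lemma contDiff_integral_pow_smul_comp_segment (a : ℝ) (k : ℕ) :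
    ∀ (j : ℕ) (F : ℝ → ℂ), ContDiff ℝ k F →
      ContDiff ℝ k (fun x => ∫ t in (0 : ℝ)..1, t ^ j • F (a + t * (x - a))) := by
  induction k with
  | zero =>
    intro j F hF
    have hc : Continuous F := hF.continuous
    rw [Nat.cast_zero, contDiff_zero]
    apply intervalIntegral.continuous_parametric_intervalIntegral_of_continuous'
    fun_prop
  | succ k ih =>
    intro j F hF
    have hF' := hF
    rw [Nat.cast_succ, contDiff_succ_iff_deriv] at hF
    obtain ⟨hd, -, hF₁⟩ := hF
    have hc : Continuous F := hd.continuous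
    have hc₁ : Continuous (deriv F) := hF₁.continuous
    have key : ∀ x₀ : ℝ, HasDerivAt (fun x => ∫ t in (0 : ℝ)..1, t ^ j • F (a + t * (x - a)))
        (∫ t in (0 : ℝ)..1, t ^ (j + 1) • deriv F (a + t * (x₀ - a))) x₀ := by
      intro x₀
      obtain ⟨C, hC⟩ := ((isCompact_closedBall x₀ 1).prod
        (isCompact_Icc (a := (0 : ℝ)) (b := 1))).exists_bound_of_continuousOn
        (f := fun p : ℝ × ℝ => p.2 ^ (j + 1) • deriv F (a + p.2 * (p.1 - a)))
        (by fun_prop)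
      refine (intervalIntegral.hasDerivAt_integral_of_dominated_loc_of_deriv_le
        (F := fun x t => t ^ j • F (a + t * (x - a)))
        (F' := fun x t => t ^ (j + 1) • deriv F (a + t * (x - a)))
        (bound := fun _ => C) (Metric.closedBall_mem_nhds x₀ one_pos) ?_ ?_ ?_ ?_ ?_ ?_).2
      · exact Filter.Eventually.of_forall fun x => by
          apply Continuous.aestronglyMeasurable
          fun_prop
      · apply Continuous.intervalIntegrable
        fun_prop
      · apply Continuous.aestronglyMeasurable
        fun_prop
      · refine Filter.Eventually.of_forall fun t ht x hx => hC (x, t) ⟨hx, ?_⟩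
        rw [Set.uIoc_of_le zero_le_one] at ht
        exact ⟨ht.1.le, ht.2⟩
      · exact intervalIntegrable_const
      · refine Filter.Eventually.of_forall fun t _ x _ => ?_
        have h₁ : HasDerivAt (fun x : ℝ => a + t * (x - a)) t x := by
          simpa using (((hasDerivAt_id x).sub_const a).const_mul t).const_add a
        have h₂ := ((hd (a + t * (x - a))).hasDerivAt.scomp x h₁).const_smul (t ^ j)
        rw [smul_smul, ← pow_succ] at h₂
        exact h₂
    rw [Nat.cast_succ, contDiff_succ_iff_deriv]
    refine ⟨fun x => (key x).differentiableAt, by simp, ?_⟩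
    rw [show deriv (fun x => ∫ t in (0 : ℝ)..1, t ^ j • F (a + t * (x - a))) = _ from
      funext fun x => (key x).deriv]
    exact ih (j + 1) (deriv F) hF₁

lemma dslope_eq_integral {f : ℝ → ℂ} (hf : ContDiff ℝ 1 f) (a x : ℝ) :
    dslope f a x = ∫ t in (0 : ℝ)..1, deriv f (a + t * (x - a)) := by
  rcases eq_or_ne x a with rfl | hx
  · simp [dslope_same]
  · have hc : Continuous (deriv f) := hf.continuous_deriv le_rfl
    have h := intervalIntegral.integral_unitInterval_deriv_eq_sub (𝕜 := ℝ) (f := f)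
      (f' := deriv f) (z₀ := a) (z₁ := x - a) (by fun_prop)
      (fun t _ => (hf.differentiable one_ne_zero _).hasDerivAt)
    rw [dslope_of_ne _ hx, slope_def_module, eq_comm, eq_inv_smul_iff₀ (sub_ne_zero.2 hx)]
    simpa using h

lemma ContDiff.dslope {f : ℝ → ℂ} {k : ℕ} (hf : ContDiff ℝ (k + 1 : ℕ) f) (a : ℝ) :
    ContDiff ℝ k (dslope f a) := by
  have h₁ : ContDiff ℝ 1 f := hf.of_le (by exact_mod_cast Nat.le_add_left 1 k)
  rw [Nat.cast_succ, contDiff_succ_iff_deriv] at hf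
  rw [show _root_.dslope f a = _ from funext fun x => dslope_eq_integral h₁ a x]
  simpa using contDiff_integral_pow_smul_comp_segment a k 0 _ hf.2.2

lemma dslope_add_of_differentiableAt {f g : ℝ → ℂ} {a : ℝ} (hf : DifferentiableAt ℝ f a)
    (hg : DifferentiableAt ℝ g a) :
    dslope (fun x => f x + g x) a = fun x => dslope f a x + dslope g a x := by
  funext x
  rcases eq_or_ne x a with rfl | hx
  · simp only [dslope_same]
    exact deriv_fun_add hf hg
  · simp only [dslope_of_ne _ hx, slope_def_module, ← smul_add]
    congr 1
    ring

lemma dslope_const_mul (c : ℂ) (f : ℝ → ℂ) (a : ℝ) :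
    dslope (fun x => c * f x) a = fun x => c * dslope f a x := by
  funext x
  rcases eq_or_ne x a with rfl | hx
  · simp only [dslope_same]
    exact deriv_const_mul_field c
  · simp only [dslope_of_ne _ hx, slope_def_module, Complex.real_smul]
    ring

lemma dslope_const_fun (c : ℂ) (a : ℝ) : dslope (fun _ : ℝ => c) a = fun _ => 0 := by
  funext x
  rcases eq_or_ne x a with rfl | hx
  · simp [dslope_same]
  · simp [dslope_of_ne _ hx, slope_def_module]

/-- Product rule for `dslope` with an affine factor, the factor evaluated at the moving point. -/
lemma dslope_mul_sub_const {f : ℝ → ℂ} {a : ℝ} (hf : DifferentiableAt ℝ f a) (c : ℂ) :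
    dslope (fun x => f x * ((x : ℂ) - c)) a =
      fun x => dslope f a x * ((x : ℂ) - c) + f a := by
  funext x
  rcases eq_or_ne x a with rfl | hx
  · simp only [dslope_same]
    have h : HasDerivAt (fun y : ℝ => (y : ℂ) - c) 1 x :=
      Complex.ofRealCLM.hasDerivAt.sub_const c
    simpa using (hf.hasDerivAt.fun_mul h).deriv
  · have h : (x : ℂ) - a ≠ 0 := by
      rw [sub_ne_zero]
      exact_mod_cast hx
    simp only [dslope_of_ne _ hx, slope_def_module, Complex.real_smul]
    push_cast
    field_simp
    ring

/-- Product rule for `dslope` with an affine factor, the factor evaluated at the base point. -/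
lemma dslope_mul_sub_const' {f : ℝ → ℂ} {a : ℝ} (hf : DifferentiableAt ℝ f a) (c : ℂ) :
    dslope (fun x => f x * ((x : ℂ) - c)) a =
      fun x => ((a : ℂ) - c) * dslope f a x + f x := by
  rw [dslope_mul_sub_const hf]
  funext x
  have h := sub_smul_dslope f a x
  rw [Complex.real_smul, Complex.ofReal_sub] at h
  linear_combination h

/-- The divided difference of `f` over a list of points, obtained by iterating `dslope`. -/
noncomputable def divDiffList : List ℝ → (ℝ → ℂ) → ℂ
  | [], _ => 0
  | [a], f => f a
  | a :: b :: L, f => divDiffList (b :: L) (dslope f a)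

lemma divDiffList_cons (a : ℝ) {L : List ℝ} (hL : L ≠ []) (f : ℝ → ℂ) :
    divDiffList (a :: L) f = divDiffList L (dslope f a) := by
  cases L with
  | nil => exact absurd rfl hL
  | cons b L => rfl

lemma divDiffList_append_pair (K : List ℝ) (a b : ℝ) (f : ℝ → ℂ) :
    divDiffList (K ++ [a, b]) f = dslope (fun x => divDiffList (K ++ [x]) f) a b := by
  induction K generalizing f with
  | nil => rfl
  | cons k K ih =>
    simp only [List.cons_append]
    rw [divDiffList_cons k (by simp), ih]
    congr 1
    funext x
    rw [divDiffList_cons k (by simp)]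

lemma divDiffList_add {N : ℕ} {L : List ℝ} (hL : L.length ≤ N + 1) {f g : ℝ → ℂ}
    (hf : ContDiff ℝ N f) (hg : ContDiff ℝ N g) :
    divDiffList L (fun x => f x + g x) = divDiffList L f + divDiffList L g := by
  induction N generalizing L f g with
  | zero =>
    match L with
    | [] => simp [divDiffList]
    | [a] => rfl
    | a :: b :: L => simp at hL
  | succ N ih =>
    match L with
    | [] => simp [divDiffList]
    | [a] => rfl
    | a :: b :: L =>
      simp only [divDiffList]
      rw [dslope_add_of_differentiableAt (hf.differentiable (by simp) a)
        (hg.differentiable (by simp) a)]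
      exact ih (by simpa using hL) (hf.dslope a) (hg.dslope a)

lemma divDiffList_const_mul (L : List ℝ) (c : ℂ) (f : ℝ → ℂ) :
    divDiffList L (fun x => c * f x) = c * divDiffList L f := by
  induction L generalizing f with
  | nil => simp [divDiffList]
  | cons a L ih =>
    cases L with
    | nil => rfl
    | cons b L =>
      simp only [divDiffList]
      rw [dslope_const_mul, ih]

lemma divDiffList_zero (L : List ℝ) : divDiffList L (fun _ => 0) = 0 := by
  simpa using divDiffList_const_mul L 0 (fun _ => 0)

/-- Leibniz rule: multiplying by an affine factor, the factor evaluated at any chosen point. -/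
lemma divDiffList_mul_sub_const {N : ℕ} (K : List ℝ) (r : ℝ) (R : List ℝ)
    (hL : (K ++ r :: R).length ≤ N + 1) {f : ℝ → ℂ} (hf : ContDiff ℝ N f) (c : ℂ) :
    divDiffList (K ++ r :: R) (fun x => f x * ((x : ℂ) - c)) =
      ((r : ℂ) - c) * divDiffList (K ++ r :: R) f + divDiffList (K ++ R) f := by
  have hu : ContDiff ℝ ⊤ (fun x : ℝ => (x : ℂ) - c) :=
    Complex.ofRealCLM.contDiff.sub contDiff_const
  induction K generalizing N f with
  | nil =>
    cases R with
    | nil => simp [divDiffList, mul_comm]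
    | cons b R =>
      obtain _ | N := N
      · simp at hL
      simp only [List.nil_append, divDiffList]
      rw [dslope_mul_sub_const' (hf.differentiable (by simp) r),
        divDiffList_add (N := N) (by simpa using hL) (contDiff_const.mul (hf.dslope r))
          (hf.of_le (by exact_mod_cast N.le_succ)), divDiffList_const_mul]
  | cons k K ih =>
    obtain _ | N := N
    · simp at hL
    simp only [List.cons_append] at hL ⊢
    have hL' : (K ++ r :: R).length ≤ N + 1 := by simpa using hL
    have hg := hf.dslope k
    rw [divDiffList_cons k (by simp), divDiffList_cons k (by simp),
      dslope_mul_sub_const (hf.differentiable (by simp) k),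
      divDiffList_add hL' (hg.mul (hu.of_le le_top)) contDiff_const, ih hL' hg, add_assoc]
    congr 1
    rcases eq_or_ne (K ++ R) [] with h | h
    · obtain ⟨rfl, rfl⟩ := List.append_eq_nil_iff.1 h
      simp [divDiffList]
    · have hconst : divDiffList (K ++ r :: R) (fun _ => f k) = 0 := by
        obtain ⟨a, b, M, hM⟩ : ∃ a b M, K ++ r :: R = a :: b :: M := by
          match K, R with
          | [], [] => simp at h
          | [], b :: R => exact ⟨_, _, _, rfl⟩
          | [a], R => exact ⟨_, _, _, rfl⟩
          | a :: b :: K, R => exact ⟨_, _, _, rfl⟩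
        rw [hM, divDiffList, dslope_const_fun, divDiffList_zero]
      rw [divDiffList_cons k h, hconst, add_zero]

lemma divDiffD_eq_divDiffList (f : ℝ → ℂ) (n : ℕ) (l : Fin (n + 1) → ℝ) :
    divDiffD f n l = divDiffList (List.ofFn l) f := by
  induction n with
  | zero => simp [divDiffD, divDiffList]
  | succ n ih =>
    set K : List ℝ := List.ofFn fun i : Fin n => l i.castSucc.castSucc with hK
    have hupd : ∀ x : ℝ, List.ofFn (Function.update (fun i : Fin (n + 1) => l i.castSucc)
        (Fin.last n) x) = K ++ [x] := by
      intro x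
      rw [List.ofFn_succ']
      simp [hK, List.concat_eq_append]
    have hinit : List.ofFn (fun i : Fin (n + 1) => l i.castSucc) =
        K ++ [l (Fin.last n).castSucc] := by
      rw [List.ofFn_succ', List.concat_eq_append]
    have hall : List.ofFn l = K ++ [l (Fin.last n).castSucc, l (Fin.last (n + 1))] := by
      rw [List.ofFn_succ', List.concat_eq_append, hinit]
      simp
    rw [hall, divDiffList_append_pair, divDiffD]
    simp only [ih, hupd, hinit]
    split_ifs with h
    · rw [h, dslope_same]
    · rw [dslope_of_ne _ h, slope_def_module, Complex.real_smul]
      push_cast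
      rw [div_eq_inv_mul]

/-- Expansion of a divided difference over the subsets of a finite set of trailing points. -/
lemma divDiffList_mul_prod_sub_const {ι : Type*} [LinearOrder ι] (l : ι → ℝ) (c : ℂ) {N : ℕ}
    (A : Finset ι) (K : List ℝ) (hA : K.length + #A ≤ N + 1) {f : ℝ → ℂ}
    (hf : ContDiff ℝ N f) :
    divDiffList (K ++ A.sort.map l) f * ∏ j ∈ A, ((l j : ℂ) - c) =
      ∑ S ∈ A.powerset, (-1 : ℂ) ^ (#A - #S) *
        divDiffList (K ++ S.sort.map l) (fun x => f x * ((x : ℂ) - c) ^ #S) := by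
  have hu : ContDiff ℝ N (fun x : ℝ => (x : ℂ) - c) :=
    Complex.ofRealCLM.contDiff.sub contDiff_const
  induction A using Finset.induction_on_min generalizing K f with
  | empty => simp
  | insert a A ha ih =>
    have haA : a ∉ A := fun h => lt_irrefl a (ha a h)
    rw [card_insert_of_notMem haA] at hA
    have hsplit := divDiffList_mul_sub_const (N := N) K (l a) (A.sort.map l)
      (by simpa using by omega) hf c
    have h₁ := ih (K ++ [l a]) (by simpa using by omega) (hf.mul hu)
    have h₂ := ih K (by omega) hf
    simp only [List.append_assoc, List.singleton_append] at h₁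
    rw [sum_powerset_insert haA, sort_insert _ (fun b hb => (ha b hb).le) haA,
      prod_insert haA, List.map_cons]
    have e₁ : ∑ S ∈ A.powerset, (-1 : ℂ) ^ (#(insert a A) - #S) *
        divDiffList (K ++ S.sort.map l) (fun x => f x * ((x : ℂ) - c) ^ #S) =
        -∑ S ∈ A.powerset, (-1 : ℂ) ^ (#A - #S) *
        divDiffList (K ++ S.sort.map l) (fun x => f x * ((x : ℂ) - c) ^ #S) := by
      rw [← sum_neg_distrib]
      refine sum_congr rfl fun S hS => ?_
      have hle := card_le_card (mem_powerset.1 hS)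
      rw [card_insert_of_notMem haA, Nat.succ_sub hle, pow_succ]
      ring
    have e₂ : ∑ S ∈ A.powerset, (-1 : ℂ) ^ (#(insert a A) - #(insert a S)) *
        divDiffList (K ++ (insert a S).sort.map l)
          (fun x => f x * ((x : ℂ) - c) ^ #(insert a S)) =
        ∑ S ∈ A.powerset, (-1 : ℂ) ^ (#A - #S) *
        divDiffList (K ++ l a :: S.sort.map l)
          (fun x => f x * ((x : ℂ) - c) * ((x : ℂ) - c) ^ #S) := by
      refine sum_congr rfl fun S hS => ?_
      have hSA := mem_powerset.1 hS
      have haS : a ∉ S := fun h => haA (hSA h)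
      rw [card_insert_of_notMem haA, card_insert_of_notMem haS, Nat.add_sub_add_right,
        sort_insert _ (fun b hb => (ha b (hSA hb)).le) haS, List.map_cons]
      simp only [pow_succ', mul_assoc]
    rw [e₁, e₂, ← h₁, ← h₂, hsplit]
    ring

/-- with `u(λ) = λ - i`, `n = m + 1 ≥ 2`, and `f ∈ C^{n-1}(ℝ)`, for all real
points `λ₀, …, λ_{n-1}`,
`f^{[n-1]}(λ₀,…,λ_{n-1}) = Σ_{p=0}^{n-1} Σ_{0<j₁<⋯<j_p≤n-1} (-1)^{n-1-p}
  (f·u^p)^{[p]}(λ₀,λ_{j₁},…,λ_{j_p}) · u(λ₁)⁻¹⋯u(λ_{n-1})⁻¹`. -/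
theorem stmt13 (m : ℕ) (hm : 1 ≤ m) (f : ℝ → ℂ) (hf : ContDiff ℝ (m : ℕ) f)
    (l : Fin (m + 1) → ℝ) :
    divDiffD f m l =
      (∑ p ∈ Finset.range (m + 1),
        ∑ s ∈ (Finset.powersetCard p ((Finset.univ : Finset (Fin (m + 1))).erase 0)).attach,
          (-1 : ℂ) ^ (m - p) *
            divDiffD (fun x => f x * ((x : ℂ) - Complex.I) ^ p) p
              (Fin.cons (l 0)
                (fun i : Fin p => l (s.1.orderEmbOfFin
                  (Finset.mem_powersetCard.mp s.2).2 i)))) *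
      ∏ j ∈ (Finset.univ : Finset (Fin (m + 1))).erase 0,
        ((l j : ℂ) - Complex.I)⁻¹ := by
  have hne : ∀ j, (l j : ℂ) - Complex.I ≠ 0 := fun j h => by
    simpa using congrArg Complex.im h
  set A : Finset (Fin (m + 1)) := univ.erase 0 with hA
  have hcard : #A = m := by simp [hA]
  have hsort : List.ofFn l = [l 0] ++ A.sort.map l := by
    have h : (univ : Finset (Fin (m + 1))).sort = 0 :: A.sort := by
      rw [← insert_erase (mem_univ (0 : Fin (m + 1))),
        sort_insert _ (fun b _ => Fin.zero_le b) (notMem_erase _ _)]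
    rw [List.ofFn_eq_map, ← Fin.sort_univ, h]
    rfl
  have hmain := divDiffList_mul_prod_sub_const l Complex.I A [l 0]
    (by simp [hcard, add_comm]) hf
  rw [← hsort, ← divDiffD_eq_divDiffList, sum_powerset, hcard] at hmain
  rw [prod_inv_distrib, ← div_eq_mul_inv, eq_div_iff (prod_ne_zero_iff.2 fun j _ => hne j),
    hmain]
  refine sum_congr rfl fun p _ => ?_
  rw [← sum_attach]
  refine sum_congr rfl fun s _ => ?_
  have hs := (mem_powersetCard.mp s.2).2
  rw [divDiffD_eq_divDiffList, List.ofFn_cons, List.ofFn_eq_map,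
    ← listMap_orderEmbOfFin_finRange s.1 hs, List.map_map]
  simp only [hs]
  rfl
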